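/- arXiv:2509.10520 — 3 statements merged into one kernel-verified Lean document; each statement's English description precedes it below -/
import Mathlib

section
/- (Lemma 1) In the CSI probabilistic model, for every action a in the finite action set, the conditional probability of Z = 1 given that the logged action B equals a and the reward Y equals 1 satisfies P(Z = 1 | B = a, Y = 1) = σ( log( r(a) / R ) ), where σ(t) = 1/(1 + exp(−t)) is the sigmoid function and R := ∑_{a' ∈ 𝒜} π₀(a') · r(a') is the expected reward under the logging policy. -/
/-!
CSI probabilistic model: the joint distribution of (A, A', Z, Y) on
𝒜 × 𝒜 × Bool × Bool, where A ~ π₀ and A' ~ π₀ independently,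
Z ~ Bernoulli(1/2) independent of (A, A'), and Y ~ Bernoulli(r(A))
conditionally on A, independent of (A', Z) given A.
An outcome ω = (A, A', Z, Y) has mass
  π₀(A) · π₀(A') · (1/2) · (r(A) if Y else 1 − r(A)).
-/

/-- Joint probability mass function of the CSI model on outcomes `(A, A', Z, Y)`. -/
noncomputable def csiJoint {𝒜 : Type*} (π₀ r : 𝒜 → ℝ)
    (ω : 𝒜 × 𝒜 × Bool × Bool) : ℝ :=
  π₀ ω.1 * π₀ ω.2.1 * (1 / 2) * (if ω.2.2.2 then r ω.1 else 1 - r ω.1)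

/-- Probability of an event under the CSI model. -/
noncomputable def csiProb {𝒜 : Type*} [Fintype 𝒜] (π₀ r : 𝒜 → ℝ)
    (E : 𝒜 × 𝒜 × Bool × Bool → Prop) [DecidablePred E] : ℝ :=
  ∑ ω : 𝒜 × 𝒜 × Bool × Bool, if E ω then csiJoint π₀ r ω else 0

/-- The logged action: `B := A` if `Z = 1` (true), else `B := A'`. -/
def loggedB {𝒜 : Type*} (ω : 𝒜 × 𝒜 × Bool × Bool) : 𝒜 :=
  if ω.2.2.1 then ω.1 else ω.2.1

/-- The sigmoid (logistic) function `σ(t) = 1 / (1 + exp(−t))`. -/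
noncomputable def sigmoid (t : ℝ) : ℝ := 1 / (1 + Real.exp (-t))

/-- **Lemma 1.** In the CSI model, for every action `a`,
`P(Z = 1 | B = a, Y = 1) = σ(log(r(a) / R))`,
where `R := ∑ a', π₀(a') · r(a')` is the expected reward under the logging
policy, and the conditional probability is the ratio
`P(Z = 1, B = a, Y = 1) / P(B = a, Y = 1)`. -/
theorem csi_cond_prob_eq_sigmoid_log_advantage
    {𝒜 : Type*} [Fintype 𝒜] [Nonempty 𝒜] [DecidableEq 𝒜]
    (π₀ r : 𝒜 → ℝ)
    (hπ_pos : ∀ a, 0 < π₀ a) (hπ_sum : ∑ a, π₀ a = 1)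
    (hr_pos : ∀ a, 0 < r a) (hr_le : ∀ a, r a ≤ 1)
    (a : 𝒜) :
    csiProb π₀ r (fun ω => ω.2.2.1 = true ∧ loggedB ω = a ∧ ω.2.2.2 = true) /
      csiProb π₀ r (fun ω => loggedB ω = a ∧ ω.2.2.2 = true)
      = sigmoid (Real.log (r a / ∑ a', π₀ a' * r a')) := by
  have h1 : csiProb π₀ r (fun ω => ω.2.2.1 = true ∧ loggedB ω = a ∧ ω.2.2.2 = true)
      = (1 / 2) * π₀ a * r a := by
    have e : ∀ x : 𝒜, (∑ y, if x = a then π₀ x * π₀ y * (1 / 2) * r x else 0)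
        = if x = a then (1 / 2) * π₀ x * r x else 0 := by
      intro x
      split_ifs
      · rw [← Finset.sum_mul, ← Finset.sum_mul, ← Finset.mul_sum, hπ_sum]; ring
      · simp
    unfold csiProb csiJoint loggedB
    simp only [Fintype.sum_prod_type, Fintype.sum_bool]
    simp only [true_and, and_true, if_true, reduceCtorEq, false_and, and_false, if_false,
      add_zero, e]
    simp
  have h2 : csiProb π₀ r (fun ω => loggedB ω = a ∧ ω.2.2.2 = true)
      = (1 / 2) * π₀ a * r a + (1 / 2) * π₀ a * ∑ a', π₀ a' * r a' := by
    have e : ∀ x : 𝒜, (∑ y, if x = a then π₀ x * π₀ y * (1 / 2) * r x else 0)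
        = if x = a then (1 / 2) * π₀ x * r x else 0 := by
      intro x
      split_ifs
      · rw [← Finset.sum_mul, ← Finset.sum_mul, ← Finset.mul_sum, hπ_sum]; ring
      · simp
    have e2 : ∀ x : 𝒜, (∑ y, if y = a then π₀ x * π₀ y * (1 / 2) * r x else 0)
        = (1 / 2) * π₀ a * (π₀ x * r x) := by
      intro x
      simp only [Finset.sum_ite_eq', Finset.mem_univ, if_true]
      ring
    unfold csiProb csiJoint loggedB
    simp only [Fintype.sum_prod_type, Fintype.sum_bool]
    simp only [and_true, if_true, reduceCtorEq, Bool.false_eq_true, and_false, if_false,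
      add_zero, Finset.sum_add_distrib, e, e2, ← Finset.mul_sum]
    simp
  have hR : 0 < ∑ a', π₀ a' * r a' :=
    Finset.sum_pos (fun x _ => mul_pos (hπ_pos x) (hr_pos x)) Finset.univ_nonempty
  rw [h1, h2]
  generalize (∑ a', π₀ a' * r a') = R at hR
  have hp := hπ_pos a
  have hra := hr_pos a
  unfold sigmoid
  rw [Real.exp_neg, Real.exp_log (div_pos hra hR)]
  field_simp
end

section
/- In the CSI probabilistic model, the map a ↦ P(Z = 1 | B = a, Y = 1) on the finite action set is strictly monotone in the reward probability: for any two actions a₁, a₂, one has P(Z = 1 | B = a₁, Y = 1) < P(Z = 1 | B = a₂, Y = 1) if and only if r(a₁) < r(a₂). Consequently, the set of actions maximizing a ↦ P(Z = 1 | B = a, Y = 1) coincides with the set of actions maximizing a ↦ r(a). -/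
theorem csi_num {𝒜 : Type*} [Fintype 𝒜] [DecidableEq 𝒜] (π₀ r : 𝒜 → ℝ)
    (hπ_sum : ∑ a, π₀ a = 1) (a : 𝒜) :
    csiProb π₀ r (fun ω => ω.2.2.1 = true ∧ loggedB ω = a ∧ ω.2.2.2 = true)
      = π₀ a * r a / 2 := by
  have h : ∀ x : 𝒜, (∑ y : 𝒜, if x = a then π₀ x * π₀ y * (1 / 2) * r x else 0)
      = if x = a then π₀ x * r x / 2 else 0 := by
    intro x
    split_ifs
    · rw [← Finset.sum_mul, ← Finset.sum_mul, ← Finset.mul_sum, hπ_sum]; ring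
    · simp
  simp only [csiProb, csiJoint, loggedB, Fintype.sum_prod_type, Fintype.sum_bool]
  simp only [true_and, and_true, and_false, false_and, if_true, if_false, add_zero,
    Bool.false_eq_true]
  simp only [h]
  simp

theorem csi_den {𝒜 : Type*} [Fintype 𝒜] [DecidableEq 𝒜] (π₀ r : 𝒜 → ℝ)
    (hπ_sum : ∑ a, π₀ a = 1) (a : 𝒜) :
    csiProb π₀ r (fun ω => loggedB ω = a ∧ ω.2.2.2 = true)
      = π₀ a * (r a + ∑ x, π₀ x * r x) / 2 := by
  have h : ∀ x : 𝒜, (∑ y : 𝒜, if x = a then π₀ x * π₀ y * (1 / 2) * r x else 0)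
      = if x = a then π₀ x * r x / 2 else 0 := by
    intro x
    split_ifs
    · rw [← Finset.sum_mul, ← Finset.sum_mul, ← Finset.mul_sum, hπ_sum]; ring
    · simp
  have h2 : (∑ x : 𝒜, π₀ x * π₀ a * (1 / 2) * r x) = π₀ a * (∑ x, π₀ x * r x) / 2 := by
    rw [Finset.mul_sum, Finset.sum_div]
    exact Finset.sum_congr rfl fun x _ => by ring
  simp only [csiProb, csiJoint, loggedB, Fintype.sum_prod_type, Fintype.sum_bool]
  simp only [true_and, and_true, and_false, false_and, if_true, if_false, add_zero,
    Bool.false_eq_true, Finset.sum_add_distrib]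
  simp only [h, Finset.sum_ite_eq', Finset.mem_univ, if_true, h2]
  ring

/-- In the CSI model, the map
`a ↦ P(Z = 1 | B = a, Y = 1)` (with the conditional probability defined as the
ratio `P(Z = 1, B = a, Y = 1) / P(B = a, Y = 1)`) is strictly monotone in the
reward probability `r`: `P(Z = 1 | B = a₁, Y = 1) < P(Z = 1 | B = a₂, Y = 1)`
iff `r a₁ < r a₂`; consequently its set of maximizers coincides with the set of
maximizers of `r`. -/
theorem csi_cond_prob_strictMono_and_argmax
    {𝒜 : Type*} [Fintype 𝒜] [Nonempty 𝒜] [DecidableEq 𝒜]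
    (π₀ r : 𝒜 → ℝ)
    (hπ_pos : ∀ a, 0 < π₀ a) (hπ_sum : ∑ a, π₀ a = 1)
    (hr_pos : ∀ a, 0 < r a) (hr_le : ∀ a, r a ≤ 1)
    (condP : 𝒜 → ℝ)
    (hcondP : ∀ a, condP a =
      csiProb π₀ r (fun ω => ω.2.2.1 = true ∧ loggedB ω = a ∧ ω.2.2.2 = true) /
        csiProb π₀ r (fun ω => loggedB ω = a ∧ ω.2.2.2 = true)) :
    (∀ a₁ a₂ : 𝒜, condP a₁ < condP a₂ ↔ r a₁ < r a₂) ∧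
      {a : 𝒜 | ∀ b : 𝒜, condP b ≤ condP a} = {a : 𝒜 | ∀ b : 𝒜, r b ≤ r a} := by
  have hR : 0 < ∑ x, π₀ x * r x :=
    Finset.sum_pos (fun x _ => mul_pos (hπ_pos x) (hr_pos x)) Finset.univ_nonempty
  have key : ∀ a, condP a = r a / (r a + ∑ x, π₀ x * r x) := by
    intro a
    rw [hcondP, csi_num π₀ r hπ_sum, csi_den π₀ r hπ_sum]
    have h1 := (hπ_pos a).ne'
    have h2 := (add_pos (hr_pos a) hR).ne'
    field_simp
  have main : ∀ a₁ a₂ : 𝒜, condP a₁ < condP a₂ ↔ r a₁ < r a₂ := by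
    intro a₁ a₂
    rw [key, key, div_lt_div_iff₀ (add_pos (hr_pos a₁) hR) (add_pos (hr_pos a₂) hR),
      mul_add, mul_add, mul_comm (r a₂) (r a₁), add_lt_add_iff_left,
      mul_lt_mul_iff_left₀ hR]
  refine ⟨main, ?_⟩
  ext a
  simp only [Set.mem_setOf_eq]
  exact forall_congr' fun b => by rw [← not_lt, main, not_lt]
end

section
/- In the CSI probabilistic model with a deterministic logging policy, the CSI target degenerates: if there exists an action a₀ with π₀(a₀) = 1 (and π₀(a) = 0 for all a ≠ a₀, with r(a₀) > 0), then P(Z = 1 | B = a₀, Y = 1) = 1/2. -/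
/-- Under a deterministic policy only outcomes with `A = A' = a₀` contribute. -/
theorem csiProb_det {𝒜 : Type*} [Fintype 𝒜] (π₀ r : 𝒜 → ℝ) (a₀ : 𝒜) (hdet : π₀ a₀ = 1)
    (hzero : ∀ a ≠ a₀, π₀ a = 0)
    (E : 𝒜 × 𝒜 × Bool × Bool → Prop) [DecidablePred E] :
    csiProb π₀ r E = ∑ z : Bool, ∑ y : Bool,
      if E (a₀, a₀, z, y) then (1 / 2) * (if y then r a₀ else 1 - r a₀) else 0 := by
  unfold csiProb
  rw [Fintype.sum_prod_type, Fintype.sum_eq_single a₀, Fintype.sum_prod_type,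
    Fintype.sum_eq_single a₀, Fintype.sum_prod_type]
  · simp only [csiJoint, hdet, one_mul]
  · intro a ha
    simp [csiJoint, hzero a ha]
  · intro a ha
    simp [csiJoint, hzero a ha]

/-- In the CSI model with a deterministic logging policy, the
CSI target degenerates: if `π₀(a₀) = 1` (and `π₀(a) = 0` for every `a ≠ a₀`,
with `r(a₀) > 0`), then `P(Z = 1 | B = a₀, Y = 1) = 1/2`, where the
conditional probability is the ratio
`P(Z = 1, B = a₀, Y = 1) / P(B = a₀, Y = 1)`. -/
theorem csi_cond_prob_deterministic_policy_eq_half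
    {𝒜 : Type*} [Fintype 𝒜] [Nonempty 𝒜] [DecidableEq 𝒜]
    (π₀ r : 𝒜 → ℝ)
    (hπ_nonneg : ∀ a, 0 ≤ π₀ a) (hπ_sum : ∑ a, π₀ a = 1)
    (hr_pos : ∀ a, 0 < r a) (hr_le : ∀ a, r a ≤ 1)
    (a₀ : 𝒜) (hdet : π₀ a₀ = 1) (hzero : ∀ a ≠ a₀, π₀ a = 0) :
    csiProb π₀ r (fun ω => ω.2.2.1 = true ∧ loggedB ω = a₀ ∧ ω.2.2.2 = true) /
      csiProb π₀ r (fun ω => loggedB ω = a₀ ∧ ω.2.2.2 = true) = 1 / 2 := by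
  have h := hr_pos a₀
  rw [csiProb_det π₀ r a₀ hdet hzero, csiProb_det π₀ r a₀ hdet hzero]
  simp [loggedB]
  field_simp
  try norm_num
end
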